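/- Let a = π/4, Δ = Δ_hex(π/4), Λ = (2Δ) × 2πℤ, σ₀(x,y,z) = (−x,−y,z+π), and let Γ₂ be the group of isometries of (ℝ³, h) generated by the translations by Λ and by σ₀ (so ℝ³/Γ₂ is the orientable Bieberbach manifold C₂ with the singular metric g_hex). Then: (i) the systole of (C₂, g_hex), i.e. the infimum of L_Δ(γ) over all g ∈ Γ₂ \ {id}, m ∈ ℝ³, and piecewise C¹ curves γ from m to g(m), equals π; and (ii) with V := 4π · ∫_{H(Δ)} cos(‖p‖) dp, the Riemannian volume of (C₂, g_hex), one has π³ > (2/√3) · V. Hence the systolic ratio of (C₂, g_hex) is strictly greater than 2/√3, the optimal systolic ratio among flat metrics on C₂. -/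

import Mathlib

open Real MeasureTheory Set

noncomputable section

/-- The point `(x, y)` of the Euclidean plane. -/
def pt2 (x y : ℝ) : EuclideanSpace ℝ (Fin 2) := (WithLp.equiv 2 (Fin 2 → ℝ)).symm ![x, y]

/-- `f : [0,1] → ℝ` is piecewise `C¹`. -/
def PC1 (f : ℝ → ℝ) : Prop :=
  ∃ (n : ℕ) (t : ℕ → ℝ), t 0 = 0 ∧ t n = 1 ∧ (∀ i < n, t i < t (i + 1)) ∧
    ContinuousOn f (Set.Icc 0 1) ∧ ∀ i < n, ContDiffOn ℝ 1 f (Set.Icc (t i) (t (i + 1)))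

/-- Length of `γ = (γ₁,γ₂,γ₃)` for the singular metric
`h = dx² + dy² + cos²(dist((x,y),Δ)) dz²`. -/
def sLen (Δ : Set (EuclideanSpace ℝ (Fin 2))) (γ₁ γ₂ γ₃ : ℝ → ℝ) : ℝ :=
  ∫ t in (0:ℝ)..1, Real.sqrt ((deriv γ₁ t) ^ 2 + (deriv γ₂ t) ^ 2 +
    Real.cos (Metric.infDist (pt2 (γ₁ t) (γ₂ t)) Δ) ^ 2 * (deriv γ₃ t) ^ 2)

/-- The hexagonal lattice `Δ_hex(a) = ℤ·(2a,0) + ℤ·(a, a√3) ⊂ ℝ²`. -/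
def ΔhexE (a : ℝ) : Set (EuclideanSpace ℝ (Fin 2)) :=
  {p | ∃ m n : ℤ, p = pt2 (2 * a * m + a * n) (a * Real.sqrt 3 * n)}

/-- The spatial lattice `Λ = (2Δ_hex(a)) × 2πℤ ⊂ ℝ³`. -/
def Λhex3 (a : ℝ) : Set (ℝ × ℝ × ℝ) :=
  {w | ∃ k₁ k₂ k₃ : ℤ, w = (4 * a * k₁ + 2 * a * k₂, 2 * a * Real.sqrt 3 * k₂, 2 * π * k₃)}

/-- The closed Voronoi cell `H(Δ)` of `0` of a planar lattice `Δ`. -/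
def vorCell (Δ : Set (EuclideanSpace ℝ (Fin 2))) : Set (EuclideanSpace ℝ (Fin 2)) :=
  {p | ∀ q ∈ Δ, ‖p‖ ≤ ‖p - q‖}

/-- The screw motion `σ₀(x,y,z) = (−x, −y, z + π)`, as a bijection of `ℝ³`. -/
def sigma0Perm : Equiv.Perm (ℝ × ℝ × ℝ) where
  toFun p := (-p.1, -p.2.1, p.2.2 + π)
  invFun p := (-p.1, -p.2.1, p.2.2 - π)
  left_inv := by rintro ⟨x, y, z⟩; simp
  right_inv := by rintro ⟨x, y, z⟩; simp

/-- The group `Γ₂` of isometries of `(ℝ³, h)` generated by the translations by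
`Λ = (2Δ_hex(π/4)) × 2πℤ` and by `σ₀`; `ℝ³/Γ₂` is the Bieberbach manifold `C₂` with the
singular metric `g_hex`. -/
def Γ₂ : Subgroup (Equiv.Perm (ℝ × ℝ × ℝ)) :=
  Subgroup.closure ((fun w => Equiv.addLeft w) '' Λhex3 (π / 4) ∪ {sigma0Perm})

theorem HasDerivAt.continuousAt_mul_of_eq_zero {φ x : ℝ → ℝ} {x' t : ℝ}
    (hφ : ContinuousAt φ t) (hx : HasDerivAt x x' t) (h0 : x t = 0) :
    HasDerivAt (fun s => φ s * x s) (φ t * x') t := by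
  rw [hasDerivAt_iff_tendsto_slope] at hx ⊢
  refine ((hφ.tendsto.mono_left nhdsWithin_le_nhds).mul hx).congr fun u => ?_
  simp only [slope_def_field, h0, mul_zero, sub_zero]
  ring

theorem HasDerivAt.sqrt_sq_add_sq {x y : ℝ → ℝ} {x' y' t : ℝ} (hx : HasDerivAt x x' t)
    (hy : HasDerivAt y y' t) (h : √(x t ^ 2 + y t ^ 2) ≠ 0) :
    HasDerivAt (fun s => √(x s ^ 2 + y s ^ 2))
      ((x t * x' + y t * y') / √(x t ^ 2 + y t ^ 2)) t := by
  have h' : x t ^ 2 + y t ^ 2 ≠ 0 := fun h0 => h (by rw [h0, sqrt_zero])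
  refine (((hx.pow 2).add (hy.pow 2)).sqrt h').congr_deriv ?_
  simp only [Pi.add_apply, Pi.pow_apply]
  field_simp
  push_cast
  ring

theorem eq_zero_of_sqrt_sq_add_sq_eq_zero {x y : ℝ} (h : √(x ^ 2 + y ^ 2) = 0) :
    x = 0 ∧ y = 0 := by
  rw [sqrt_eq_zero (by positivity)] at h
  constructor <;> nlinarith [sq_nonneg x, sq_nonneg y]

theorem Real.cos_eq_one_sub_sinc_sq (r : ℝ) : cos r = 1 - sinc (r / 2) ^ 2 / 2 * r ^ 2 := by
  rcases eq_or_ne r 0 with rfl | h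
  · simp
  · rw [sinc_of_ne_zero (by positivity), ← mul_div_cancel₀ r two_ne_zero, cos_two_mul, cos_sq']
    field_simp
    ring

theorem hasDerivAt_cos_sqrt {x y : ℝ → ℝ} {x' y' t : ℝ} (hx : HasDerivAt x x' t)
    (hy : HasDerivAt y y' t) :
    HasDerivAt (fun s => cos √(x s ^ 2 + y s ^ 2))
      (-(sinc √(x t ^ 2 + y t ^ 2) * (x t * x' + y t * y'))) t := by
  by_cases h : √(x t ^ 2 + y t ^ 2) = 0
  · obtain ⟨hx0, hy0⟩ := eq_zero_of_sqrt_sq_add_sq_eq_zero h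
    have hc : ContinuousAt (fun s => sinc (√(x s ^ 2 + y s ^ 2) / 2) ^ 2 / 2) t := by
      have := hx.continuousAt
      have := hy.continuousAt
      refine ContinuousAt.div_const (ContinuousAt.pow (continuous_sinc.continuousAt.comp ?_) 2) 2
      fun_prop
    have hq := HasDerivAt.continuousAt_mul_of_eq_zero hc ((hx.pow 2).add (hy.pow 2))
      (by simp [hx0, hy0])
    refine ((hq.const_sub 1).congr_deriv (by simp [hx0, hy0])).congr_of_eventuallyEq
      (.of_forall fun s => ?_)
    simp only [Pi.add_apply, Pi.pow_apply]
    rw [cos_eq_one_sub_sinc_sq, sq_sqrt (by positivity)]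
  · refine (hx.sqrt_sq_add_sq hy h).cos.congr_deriv ?_
    rw [sinc_of_ne_zero h]
    ring

theorem hasDerivAt_sinc_sqrt_mul {x y : ℝ → ℝ} {x' y' t : ℝ} (hx : HasDerivAt x x' t)
    (hy : HasDerivAt y y' t) {w : ℝ → ℝ} {w' : ℝ} (hw : HasDerivAt w w' t)
    (h0 : √(x t ^ 2 + y t ^ 2) = 0 → w t = 0) :
    HasDerivAt (fun s => sinc √(x s ^ 2 + y s ^ 2) * w s)
      (sinc √(x t ^ 2 + y t ^ 2) * w' +
        (cos √(x t ^ 2 + y t ^ 2) - sinc √(x t ^ 2 + y t ^ 2)) / √(x t ^ 2 + y t ^ 2) ^ 2 *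
          (x t * x' + y t * y') * w t) t := by
  by_cases h : √(x t ^ 2 + y t ^ 2) = 0
  · have hc : ContinuousAt (fun s => sinc √(x s ^ 2 + y s ^ 2)) t := by
      have := hx.continuousAt
      have := hy.continuousAt
      refine continuous_sinc.continuousAt.comp ?_
      fun_prop
    refine (HasDerivAt.continuousAt_mul_of_eq_zero hc hw (h0 h)).congr_deriv ?_
    rw [h0 h, mul_zero, add_zero]
  · have hr := hx.sqrt_sq_add_sq hy h
    have hs : HasDerivAt (fun s => sinc √(x s ^ 2 + y s ^ 2)) _ t :=
      (hr.sin.div hr h).congr_of_eventuallyEq (by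
        filter_upwards [hr.continuousAt.eventually_ne h] with s hs
        simp [sinc_of_ne_zero hs])
    refine (hs.mul hw).congr_deriv ?_
    rw [sinc_of_ne_zero h]
    field_simp
    ring

theorem sinc_sq_mul_add_cos_sq (r : ℝ) : sinc r ^ 2 * r ^ 2 + cos r ^ 2 = 1 := by
  rcases eq_or_ne r 0 with rfl | h
  · simp
  · rw [sinc_of_ne_zero h, div_pow, div_mul_cancel₀ _ (pow_ne_zero 2 h), sin_sq_add_cos_sq]

/-- The velocity of a unit speed curve on the sphere controls the derivative of a linear
coordinate. -/
theorem sq_sum_mul_le_of_sphere {ι : Type*} [Fintype ι] {X v D : ι → ℝ} {S : ℝ}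
    (hX : ∑ i, X i ^ 2 = 1) (hv : ∑ i, v i ^ 2 = 1) (hXD : ∑ i, X i * D i = 0)
    (hD : ∑ i, D i ^ 2 ≤ S) :
    (∑ i, D i * v i) ^ 2 ≤ S * (1 - (∑ i, X i * v i) ^ 2) := by
  set f := ∑ i, X i * v i with hf
  have h1 : ∑ i, D i * (v i - f * X i) = ∑ i, D i * v i := by
    have : ∀ i, D i * (v i - f * X i) = D i * v i - f * (X i * D i) := fun i => by ring
    simp only [this, Finset.sum_sub_distrib, ← Finset.mul_sum, hXD, mul_zero, sub_zero]
  have h2 : ∑ i, (v i - f * X i) ^ 2 = 1 - f ^ 2 := by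
    have : ∀ i, (v i - f * X i) ^ 2 = v i ^ 2 - 2 * f * (X i * v i) + f ^ 2 * X i ^ 2 :=
      fun i => by ring
    simp only [this, Finset.sum_sub_distrib, Finset.sum_add_distrib, ← Finset.mul_sum, hX, hv,
      ← hf]
    ring
  rw [← h1]
  refine (Finset.sum_mul_sq_le_sq_mul_sq _ _ _).trans ?_
  rw [h2]
  exact mul_le_mul_of_nonneg_right hD (h2 ▸ Finset.sum_nonneg fun i _ => sq_nonneg _)

/-- The map `(x, y, z) ↦ (sin r · (x, y) / r, cos r · e^{iz})` to the round three-sphere, where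
`r = √(x² + y²)`. -/
def spherePt (x y z : ℝ) : Fin 4 → ℝ :=
  ![sinc √(x ^ 2 + y ^ 2) * x, sinc √(x ^ 2 + y ^ 2) * y,
    cos √(x ^ 2 + y ^ 2) * cos z, cos √(x ^ 2 + y ^ 2) * sin z]

theorem sum_spherePt_sq (x y z : ℝ) : ∑ i, spherePt x y z i ^ 2 = 1 := by
  have h := sinc_sq_mul_add_cos_sq √(x ^ 2 + y ^ 2)
  rw [sq_sqrt (by positivity)] at h
  simp only [spherePt, Fin.sum_univ_four, Matrix.cons_val]
  linear_combination h + cos √(x ^ 2 + y ^ 2) ^ 2 * sin_sq_add_cos_sq z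

theorem spherePt_neg_neg_add_odd_pi (x y z : ℝ) (k : ℤ) :
    spherePt (-x) (-y) (z + (2 * π * k + π)) = -spherePt x y z := by
  have e : z + (2 * π * k + π) = (z + π) + k * (2 * π) := by ring
  ext i
  fin_cases i <;>
    simp [spherePt, e, cos_add_int_mul_two_pi, sin_add_int_mul_two_pi, cos_add_pi, sin_add_pi]

/-- The map `spherePt` does not increase lengths for the metric
`dx² + dy² + cos²(√(x² + y²)) dz²`. -/
theorem exists_hasDerivAt_spherePt {x y z : ℝ → ℝ} {x' y' z' t : ℝ} (hx : HasDerivAt x x' t)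
    (hy : HasDerivAt y y' t) (hz : HasDerivAt z z' t) :
    ∃ D : Fin 4 → ℝ, (∀ i, HasDerivAt (fun s => spherePt (x s) (y s) (z s) i) (D i) t) ∧
      ∑ i, spherePt (x t) (y t) (z t) i * D i = 0 ∧
      ∑ i, D i ^ 2 ≤ x' ^ 2 + y' ^ 2 + cos √(x t ^ 2 + y t ^ 2) ^ 2 * z' ^ 2 := by
  have hw := hasDerivAt_cos_sqrt hx hy
  have d1 := hasDerivAt_sinc_sqrt_mul hx hy hx fun h => (eq_zero_of_sqrt_sq_add_sq_eq_zero h).1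
  have d2 := hasDerivAt_sinc_sqrt_mul hx hy hy fun h => (eq_zero_of_sqrt_sq_add_sq_eq_zero h).2
  have d3 := hw.mul hz.cos
  have d4 := hw.mul hz.sin
  have hD : ∀ {a b c d : ℝ}, HasDerivAt (fun s => spherePt (x s) (y s) (z s) 0) a t →
      HasDerivAt (fun s => spherePt (x s) (y s) (z s) 1) b t →
      HasDerivAt (fun s => spherePt (x s) (y s) (z s) 2) c t →
      HasDerivAt (fun s => spherePt (x s) (y s) (z s) 3) d t →
      ∀ i, HasDerivAt (fun s => spherePt (x s) (y s) (z s) i) (![a, b, c, d] i) t := by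
    intro a b c d ha hb hc hd i
    fin_cases i <;> assumption
  refine ⟨_, hD d1 d2 d3 d4, ?_, ?_⟩
  all_goals
    have hsc := sinc_sq_mul_add_cos_sq √(x t ^ 2 + y t ^ 2)
    have hr2 : √(x t ^ 2 + y t ^ 2) ^ 2 = x t ^ 2 + y t ^ 2 := sq_sqrt (by positivity)
    have hzt := sin_sq_add_cos_sq (z t)
    have hs1 : sinc √(x t ^ 2 + y t ^ 2) ^ 2 ≤ 1 :=
      (sq_le_one_iff_abs_le_one _).2 (abs_sinc_le_one _)
    have h0 := @eq_zero_of_sqrt_sq_add_sq_eq_zero (x t) (y t)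
    simp only [spherePt, Fin.sum_univ_four, Matrix.cons_val]
    generalize sinc √(x t ^ 2 + y t ^ 2) = s at *
    generalize cos √(x t ^ 2 + y t ^ 2) = w at *
    generalize √(x t ^ 2 + y t ^ 2) = r at *
    generalize x t = X at *
    generalize y t = Y at *
    generalize cos (z t) = C at *
    generalize sin (z t) = Z at *
    obtain ⟨ρ, hρ⟩ : ∃ ρ, ρ = (w - s) / r ^ 2 := ⟨_, rfl⟩
    rw [← hρ]
  · have hmain : s * (X * x' + Y * y') * (s + ρ * r ^ 2 - w) = 0 := by
      by_cases h : r = 0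
      · simp [h0 h]
      · rw [hρ, div_mul_cancel₀ _ (pow_ne_zero 2 h)]; ring
    rw [hr2] at hmain
    linear_combination hmain - s * (X * x' + Y * y') * w * hzt
  · have hmain : s ^ 2 * (x' ^ 2 + y' ^ 2) +
        (X * x' + Y * y') ^ 2 * (2 * s * ρ + ρ ^ 2 * r ^ 2 + s ^ 2) ≤ x' ^ 2 + y' ^ 2 := by
      by_cases h : r = 0
      · simp only [h0 h, zero_mul, add_zero, ne_eq, OfNat.ofNat_ne_zero, not_false_eq_true,
          zero_pow]
        nlinarith [add_nonneg (sq_nonneg x') (sq_nonneg y')]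
      · have hq : (X * x' + Y * y') ^ 2 / r ^ 2 ≤ x' ^ 2 + y' ^ 2 := by
          rw [div_le_iff₀ (by positivity), hr2]
          nlinarith [sq_nonneg (X * y' - Y * x')]
        have e : (X * x' + Y * y') ^ 2 * (2 * s * ρ + ρ ^ 2 * r ^ 2 + s ^ 2) =
            (X * x' + Y * y') ^ 2 / r ^ 2 * (1 - s ^ 2) := by
          rw [hρ]
          field_simp
          linear_combination (X * x' + Y * y') ^ 2 * hsc
        rw [e]
        nlinarith [mul_le_mul_of_nonneg_right hq (sub_nonneg.2 hs1)]
    rw [hr2] at hmain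
    refine le_trans (le_of_eq ?_) (add_le_add_left hmain (w ^ 2 * z' ^ 2))
    linear_combination (w ^ 2 * z' ^ 2 + s ^ 2 * (X * x' + Y * y') ^ 2) * hzt

theorem abs_deriv_arcsin_le {f f' S k : ℝ} (hk : k ^ 2 ≤ 1)
    (h : f' ^ 2 ≤ S ^ 2 * (1 - f ^ 2)) (hkf : 0 < 1 - (k * f) ^ 2) (hS : 0 ≤ S) :
    |1 / √(1 - (k * f) ^ 2) * (k * f')| ≤ S := by
  rw [one_div, inv_mul_eq_div, abs_div, abs_of_pos (sqrt_pos.2 hkf), div_le_iff₀ (sqrt_pos.2 hkf)]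
  refine abs_le_of_sq_le_sq ?_ (by positivity)
  rw [mul_pow, mul_pow, sq_sqrt hkf.le]
  have h1 : k ^ 2 * f' ^ 2 ≤ k ^ 2 * (S ^ 2 * (1 - f ^ 2)) := by gcongr
  nlinarith [mul_nonneg (sq_nonneg S) (sub_nonneg.2 hk)]

theorem PC1.piecewise_regular {f : ℝ → ℝ} (hf : PC1 f) :
    ∃ T : Set ℝ, T.Countable ∧ ∃ M : ℝ, ∀ t ∈ Ioo (0 : ℝ) 1 \ T,
      DifferentiableAt ℝ f t ∧ |deriv f t| ≤ M := by
  obtain ⟨n, t, h0, hn, hlt, -, hdiff⟩ := hf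
  have hbound : ∀ i, ∃ M : ℝ, i < n → ∀ s ∈ Ioo (t i) (t (i + 1)), |deriv f s| ≤ M := by
    intro i
    by_cases hi : i < n
    · obtain ⟨M, hM⟩ := isCompact_Icc.exists_bound_of_continuousOn
        ((hdiff i hi).continuousOn_derivWithin (uniqueDiffOn_Icc (hlt i hi)) le_rfl)
      refine ⟨M, fun _ s hs => ?_⟩
      rw [← derivWithin_of_mem_nhds (Icc_mem_nhds hs.1 hs.2)]
      exact hM s (Ioo_subset_Icc_self hs)
    · exact ⟨0, fun h => absurd h hi⟩
  choose M hM using hbound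
  refine ⟨t '' (Finset.range (n + 1)), ((Finset.finite_toSet _).image t).countable,
    ∑ i ∈ Finset.range n, |M i|, fun s hs => ?_⟩
  have hcover : ∀ k ≤ n, s < t k → ∃ i < k, s ∈ Ioo (t i) (t (i + 1)) := by
    intro k
    induction k with
    | zero => intro _ h; exact absurd h (by rw [h0]; exact not_lt.2 hs.1.1.le)
    | succ k ih =>
      intro hk h
      rcases lt_trichotomy s (t k) with h' | h' | h'
      · obtain ⟨i, hi, hi'⟩ := ih (by omega) h'
        exact ⟨i, by omega, hi'⟩
      · exact absurd ⟨k, by simp; omega, h'.symm⟩ hs.2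
      · exact ⟨k, by omega, h', h⟩
  obtain ⟨i, hi, hsi⟩ := hcover n le_rfl (hn ▸ hs.1.2)
  refine ⟨((hdiff i hi).differentiableOn one_ne_zero).differentiableAt
    (Icc_mem_nhds hsi.1 hsi.2), ?_⟩
  calc |deriv f s| ≤ |M i| := (hM i hi s hsi).trans (le_abs_self _)
    _ ≤ _ := Finset.single_le_sum (f := fun i => |M i|) (fun _ _ => abs_nonneg _)
        (Finset.mem_range.2 hi)

theorem PC1.continuousOn {f : ℝ → ℝ} (hf : PC1 f) : ContinuousOn f (Icc 0 1) := by
  obtain ⟨n, t, -, -, -, h, -⟩ := hf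
  exact h

theorem sub_le_integral_of_abs_hasDerivAt_le_off_countable {g g' S : ℝ → ℝ} {a b : ℝ}
    (hab : a ≤ b) {T : Set ℝ} (hT : T.Countable) (hg : ContinuousOn g (Icc a b))
    (hd : ∀ t ∈ Ioo a b \ T, HasDerivAt g (g' t) t ∧ |g' t| ≤ S t)
    (hS : IntervalIntegrable S volume a b) : g b - g a ≤ ∫ t in a..b, S t := by
  have hae : ∀ᵐ t ∂volume.restrict (Ioc a b), t ∈ Ioo a b \ T := by
    rw [← restrict_Ioo_eq_restrict_Ioc]
    filter_upwards [ae_restrict_mem measurableSet_Ioo,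
      ae_restrict_of_ae (hT.ae_notMem volume)] with t h1 h2 using ⟨h1, h2⟩
  have hle : ∀ᵐ t ∂volume.restrict (Ioc a b), |deriv g t| ≤ S t := by
    filter_upwards [hae] with t ht
    rw [(hd t ht).1.deriv]
    exact (hd t ht).2
  have hint : IntervalIntegrable (deriv g) volume a b := by
    rw [intervalIntegrable_iff_integrableOn_Ioc_of_le hab] at hS ⊢
    exact Integrable.mono' hS (measurable_deriv g).aestronglyMeasurable hle
  rw [← integral_eq_of_hasDerivAt_off_countable_of_le g (deriv g) hab hT hg
    (fun t ht => (hd t ht).1.differentiableAt.hasDerivAt) hint]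
  refine intervalIntegral.integral_mono_ae_restrict hab hint hS ?_
  rw [← restrict_Ioc_eq_restrict_Icc]
  filter_upwards [hle] with t ht using (le_abs_self _).trans ht

theorem norm_pt2 (x y : ℝ) : ‖pt2 x y‖ = √(x ^ 2 + y ^ 2) := by
  simp [pt2, EuclideanSpace.norm_eq]

theorem pt2_sub (x y u v : ℝ) : pt2 x y - pt2 u v = pt2 (x - u) (y - v) := by
  ext i; fin_cases i <;> simp [pt2]

theorem continuous_pt2 : Continuous fun p : ℝ × ℝ => pt2 p.1 p.2 := by
  unfold pt2
  simp only [WithLp.equiv_symm_apply]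
  refine (PiLp.continuous_toLp 2 _).comp (continuous_pi fun i => ?_)
  fin_cases i <;> simp <;> fun_prop

/-- The integrand of `sLen`. -/
def sSpeed (Δ : Set (EuclideanSpace ℝ (Fin 2))) (γ₁ γ₂ γ₃ : ℝ → ℝ) (t : ℝ) : ℝ :=
  √((deriv γ₁ t) ^ 2 + (deriv γ₂ t) ^ 2 +
    cos (Metric.infDist (pt2 (γ₁ t) (γ₂ t)) Δ) ^ 2 * (deriv γ₃ t) ^ 2)

section curve

variable {Δ : Set (EuclideanSpace ℝ (Fin 2))} {γ₁ γ₂ γ₃ : ℝ → ℝ}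

theorem intervalIntegrable_sSpeed (h₁ : PC1 γ₁) (h₂ : PC1 γ₂) (h₃ : PC1 γ₃) :
    IntervalIntegrable (sSpeed Δ γ₁ γ₂ γ₃) volume 0 1 := by
  obtain ⟨T₁, hT₁, M₁, hM₁⟩ := h₁.piecewise_regular
  obtain ⟨T₂, hT₂, M₂, hM₂⟩ := h₂.piecewise_regular
  obtain ⟨T₃, hT₃, M₃, hM₃⟩ := h₃.piecewise_regular
  rw [intervalIntegrable_iff_integrableOn_Ioc_of_le zero_le_one]
  have hdist : AEStronglyMeasurable
      (fun t => Metric.infDist (pt2 (γ₁ t) (γ₂ t)) Δ) (volume.restrict (Ioc 0 1)) := by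
    refine ContinuousOn.aestronglyMeasurable ?_ measurableSet_Ioc
    have hγ : ContinuousOn (fun t => (γ₁ t, γ₂ t)) (Ioc 0 1) :=
      (h₁.continuousOn.mono Ioc_subset_Icc_self).prodMk
        (h₂.continuousOn.mono Ioc_subset_Icc_self)
    have hp : ContinuousOn (fun t => pt2 (γ₁ t) (γ₂ t)) (Ioc 0 1) :=
      continuous_pt2.comp_continuousOn hγ
    exact (Metric.continuous_infDist_pt Δ).comp_continuousOn hp
  have hmeas : AEStronglyMeasurable (sSpeed Δ γ₁ γ₂ γ₃) (volume.restrict (Ioc 0 1)) := by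
    have hc := hdist.aemeasurable
    have m₁ := (measurable_deriv γ₁)
    have m₂ := (measurable_deriv γ₂)
    have m₃ := (measurable_deriv γ₃)
    unfold sSpeed
    refine AEMeasurable.aestronglyMeasurable ?_
    fun_prop
  refine Integrable.mono' (integrable_const (√(M₁ ^ 2 + M₂ ^ 2 + M₃ ^ 2))) hmeas ?_
  rw [← restrict_Ioo_eq_restrict_Ioc]
  filter_upwards [ae_restrict_mem measurableSet_Ioo, ae_restrict_of_ae (hT₁.ae_notMem volume),
    ae_restrict_of_ae (hT₂.ae_notMem volume), ae_restrict_of_ae (hT₃.ae_notMem volume)]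
    with t h0 k₁ k₂ k₃
  have b₁ := sq_le_sq' (abs_le.1 (hM₁ t ⟨h0, k₁⟩).2).1 (abs_le.1 (hM₁ t ⟨h0, k₁⟩).2).2
  have b₂ := sq_le_sq' (abs_le.1 (hM₂ t ⟨h0, k₂⟩).2).1 (abs_le.1 (hM₂ t ⟨h0, k₂⟩).2).2
  have b₃ := sq_le_sq' (abs_le.1 (hM₃ t ⟨h0, k₃⟩).2).1 (abs_le.1 (hM₃ t ⟨h0, k₃⟩).2).2
  have hcos := cos_sq_le_one (Metric.infDist (pt2 (γ₁ t) (γ₂ t)) Δ)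
  rw [Real.norm_eq_abs, sSpeed, abs_of_nonneg (sqrt_nonneg _)]
  refine sqrt_le_sqrt ?_
  nlinarith [mul_le_mul_of_nonneg_right hcos (sq_nonneg (deriv γ₃ t))]

/-- A function along a piecewise `C¹` curve whose derivative is dominated by the speed grows by at
most the length. -/
theorem sub_le_integral_sSpeed (h₁ : PC1 γ₁) (h₂ : PC1 γ₂) (h₃ : PC1 γ₃) {a b : ℝ}
    (ha : 0 ≤ a) (hab : a ≤ b) (hb : b ≤ 1) {g g' : ℝ → ℝ} (hg : ContinuousOn g (Icc a b))
    (hd : ∀ t ∈ Ioo a b, DifferentiableAt ℝ γ₁ t → DifferentiableAt ℝ γ₂ t →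
      DifferentiableAt ℝ γ₃ t → HasDerivAt g (g' t) t ∧ |g' t| ≤ sSpeed Δ γ₁ γ₂ γ₃ t) :
    g b - g a ≤ ∫ t in a..b, sSpeed Δ γ₁ γ₂ γ₃ t := by
  obtain ⟨T₁, hT₁, M₁, hM₁⟩ := h₁.piecewise_regular
  obtain ⟨T₂, hT₂, M₂, hM₂⟩ := h₂.piecewise_regular
  obtain ⟨T₃, hT₃, M₃, hM₃⟩ := h₃.piecewise_regular
  refine sub_le_integral_of_abs_hasDerivAt_le_off_countable (g' := g') hab
    ((hT₁.union hT₂).union hT₃) hg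
    (fun t ht => ?_) ((intervalIntegrable_sSpeed h₁ h₂ h₃).mono_set ?_)
  · have h0 : t ∈ Ioo (0 : ℝ) 1 := ⟨ha.trans_lt ht.1.1, ht.1.2.trans_le hb⟩
    have hT := ht.2
    simp only [mem_union, not_or] at hT
    exact hd t ht.1 (hM₁ t ⟨h0, hT.1.1⟩).1 (hM₂ t ⟨h0, hT.1.2⟩).1 (hM₃ t ⟨h0, hT.2⟩).1
  · rw [uIcc_of_le hab, uIcc_of_le zero_le_one]
    exact Icc_subset_Icc ha hb

/-- The projection to the horizontal plane does not increase length. -/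
theorem sqrt_le_integral_sSpeed (h₁ : PC1 γ₁) (h₂ : PC1 γ₂) (h₃ : PC1 γ₃) {a b : ℝ}
    (ha : 0 ≤ a) (hab : a ≤ b) (hb : b ≤ 1) :
    √((γ₁ b - γ₁ a) ^ 2 + (γ₂ b - γ₂ a) ^ 2) ≤ ∫ t in a..b, sSpeed Δ γ₁ γ₂ γ₃ t := by
  set r := √((γ₁ b - γ₁ a) ^ 2 + (γ₂ b - γ₂ a) ^ 2) with hr
  have hr2 : r ^ 2 = (γ₁ b - γ₁ a) ^ 2 + (γ₂ b - γ₂ a) ^ 2 := sq_sqrt (by positivity)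
  rcases (show 0 ≤ r from sqrt_nonneg _).eq_or_lt with h0 | h0
  · rw [← h0]
    exact intervalIntegral.integral_nonneg hab fun t _ => sqrt_nonneg _
  set α := (γ₁ b - γ₁ a) / r with hα
  set β := (γ₂ b - γ₂ a) / r with hβ
  have hαβ : α ^ 2 + β ^ 2 = 1 := by
    rw [hα, hβ, div_pow, div_pow, ← add_div, ← hr2, div_self (by positivity)]
  have hsub : Icc a b ⊆ Icc 0 1 := Icc_subset_Icc ha hb
  have key := sub_le_integral_sSpeed (Δ := Δ) (g := fun t => α * γ₁ t + β * γ₂ t)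
    (g' := fun t => α * deriv γ₁ t + β * deriv γ₂ t) h₁ h₂ h₃ ha hab hb
    (((h₁.continuousOn.mono hsub).const_mul α).add ((h₂.continuousOn.mono hsub).const_mul β))
    (fun t _ d₁ d₂ _ => ⟨(d₁.hasDerivAt.const_mul α).add (d₂.hasDerivAt.const_mul β), ?_⟩)
  · refine le_trans (le_of_eq ?_) key
    have : α * γ₁ b + β * γ₂ b - (α * γ₁ a + β * γ₂ a) = r ^ 2 / r := by
      rw [hr2, hα, hβ]; ring
    rw [this]; field_simp
  · refine abs_le_sqrt ?_
    have := mul_nonneg (sq_nonneg (cos (Metric.infDist (pt2 (γ₁ t) (γ₂ t)) Δ)))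
      (sq_nonneg (deriv γ₃ t))
    nlinarith [sq_nonneg (α * deriv γ₂ t - β * deriv γ₁ t),
      congrArg (· * ((deriv γ₁ t) ^ 2 + (deriv γ₂ t) ^ 2)) hαβ]

theorem infDist_pt2_le {q₁ q₂ : ℝ} (hq : pt2 q₁ q₂ ∈ Δ) (x y : ℝ) :
    Metric.infDist (pt2 x y) Δ ≤ √((x - q₁) ^ 2 + (y - q₂) ^ 2) := by
  rw [← norm_pt2, ← pt2_sub, ← dist_eq_norm]
  exact Metric.infDist_le_dist_of_mem hq

/-- A curve that stays close to the axis over a point of `Δ` and whose end point is obtained from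
its starting point by a half-turn screw motion about that axis projects to a curve joining antipodal
points of the three-sphere. -/
theorem pi_le_integral_sSpeed_of_near (h₁ : PC1 γ₁) (h₂ : PC1 γ₂) (h₃ : PC1 γ₃) {q₁ q₂ : ℝ}
    (hq : pt2 q₁ q₂ ∈ Δ) (k : ℤ) (e₁ : γ₁ 1 = 2 * q₁ - γ₁ 0) (e₂ : γ₂ 1 = 2 * q₂ - γ₂ 0)
    (e₃ : γ₃ 1 = γ₃ 0 + (2 * π * k + π))
    (hnear : ∀ t ∈ Icc (0 : ℝ) 1, √((γ₁ t - q₁) ^ 2 + (γ₂ t - q₂) ^ 2) ≤ π / 2) :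
    π ≤ ∫ t in (0 : ℝ)..1, sSpeed Δ γ₁ γ₂ γ₃ t := by
  set X : ℝ → Fin 4 → ℝ := fun t => spherePt (γ₁ t - q₁) (γ₂ t - q₂) (γ₃ t) with hX
  set f : ℝ → ℝ := fun t => ∑ i, X t i * X 0 i with hf
  have hsum : ∀ t, ∑ i, X t i ^ 2 = 1 := fun t => sum_spherePt_sq _ _ _
  have hf0 : f 0 = 1 := by
    rw [← hsum 0]; exact Finset.sum_congr rfl fun i _ => (sq _).symm
  have hf1 : f 1 = -1 := by
    have : X 1 = -X 0 := by
      simp only [hX]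
      rw [← spherePt_neg_neg_add_odd_pi _ _ _ k, e₁, e₂, e₃]
      congr 1 <;> ring
    have hneg : f 1 = -f 0 := by
      simp only [hf, this, Pi.neg_apply, neg_mul, Finset.sum_neg_distrib]
    rw [hneg, hf0]
  have hfle : ∀ t, f t ^ 2 ≤ 1 := fun t =>
    (Finset.sum_mul_sq_le_sq_mul_sq _ _ _).trans (by rw [hsum, hsum, one_mul])
  have hfc : ContinuousOn f (Icc 0 1) := by
    have c₁ := h₁.continuousOn
    have c₂ := h₂.continuousOn
    have c₃ := h₃.continuousOn
    have hr : ContinuousOn (fun t => √((γ₁ t - q₁) ^ 2 + (γ₂ t - q₂) ^ 2)) (Icc 0 1) := by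
      fun_prop
    have hs := continuous_sinc.comp_continuousOn hr
    have hw := continuous_cos.comp_continuousOn hr
    simp only [Function.comp_def] at hs hw
    simp only [hf, hX, spherePt, Fin.sum_univ_four, Matrix.cons_val]
    fun_prop
  have hbound : ∀ k ∈ Ioo (0 : ℝ) 1, 2 * arcsin k ≤ ∫ t in (0 : ℝ)..1, sSpeed Δ γ₁ γ₂ γ₃ t := by
    intro k hk
    have hk2 : k ^ 2 < 1 := by nlinarith [hk.1, hk.2]
    have hpos : ∀ t, 0 < 1 - (k * f t) ^ 2 := fun t => by
      nlinarith [hfle t, sq_nonneg k, sq_nonneg (f t), mul_pow k (f t) 2]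
    have key := sub_le_integral_sSpeed (Δ := Δ) (g := fun t => -arcsin (k * f t))
      (g' := fun t => -(1 / √(1 - (k * f t) ^ 2) * (k * deriv f t))) h₁ h₂ h₃ le_rfl
      zero_le_one le_rfl (continuous_arcsin.comp_continuousOn (hfc.const_mul k)).neg
      (fun t ht d₁ d₂ d₃ => ?_)
    · rw [hf0, hf1] at key
      simp only [mul_neg, mul_one, arcsin_neg] at key
      linarith
    · obtain ⟨D, hD, hXD, hDle⟩ := exists_hasDerivAt_spherePt (d₁.hasDerivAt.sub_const q₁)
        (d₂.hasDerivAt.sub_const q₂) d₃.hasDerivAt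
      have hfd : HasDerivAt f (∑ i, D i * X 0 i) t :=
        HasDerivAt.fun_sum fun i _ => (hD i).mul_const (X 0 i)
      have hne : k * f t ≠ -1 ∧ k * f t ≠ 1 := by
        constructor <;> intro h <;> have := hpos t <;> rw [h] at this <;> norm_num at this
      rw [hfd.deriv, abs_neg]
      refine ⟨((hasDerivAt_arcsin hne.1 hne.2).comp (h := fun s => k * f s) t
        (hfd.const_mul k)).neg, ?_⟩
      refine abs_deriv_arcsin_le hk2.le ?_ (hpos t) (sqrt_nonneg _)
      refine sq_sum_mul_le_of_sphere (hsum t) (hsum 0) hXD (hDle.trans ?_)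
      rw [sSpeed, sq_sqrt (by positivity)]
      have hcos : cos √((γ₁ t - q₁) ^ 2 + (γ₂ t - q₂) ^ 2) ≤
          cos (Metric.infDist (pt2 (γ₁ t) (γ₂ t)) Δ) := by
        refine cos_le_cos_of_nonneg_of_le_pi Metric.infDist_nonneg ?_ (infDist_pt2_le hq _ _)
        linarith [hnear t (Ioo_subset_Icc_self ht), pi_pos]
      have hcos0 : 0 ≤ cos √((γ₁ t - q₁) ^ 2 + (γ₂ t - q₂) ^ 2) :=
        cos_nonneg_of_neg_pi_div_two_le_of_le
          (by linarith [sqrt_nonneg ((γ₁ t - q₁) ^ 2 + (γ₂ t - q₂) ^ 2), pi_pos])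
          (hnear t (Ioo_subset_Icc_self ht))
      gcongr
  have hlim : Filter.Tendsto (fun k => 2 * arcsin k) (nhdsWithin 1 (Iio 1))
      (nhds (2 * arcsin 1)) :=
    ((continuous_arcsin.const_mul 2).tendsto 1).mono_left nhdsWithin_le_nhds
  have hle := le_of_tendsto hlim (by
    filter_upwards [Ioo_mem_nhdsLT zero_lt_one] with k hk using hbound k hk)
  rw [arcsin_one] at hle
  linarith

theorem two_mul_sqrt_le_sqrt_add_sqrt (a b c d : ℝ) :
    2 * √(a ^ 2 + b ^ 2) ≤ √((a - c) ^ 2 + (b - d) ^ 2) + √((-c - a) ^ 2 + (-d - b) ^ 2) := by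
  have h := norm_add_le (pt2 (a - c) (b - d)) (-pt2 (-c - a) (-d - b))
  have e : pt2 (a - c) (b - d) + -pt2 (-c - a) (-d - b) = (2 : ℝ) • pt2 a b := by
    ext i; fin_cases i <;> simp [pt2] <;> ring
  rw [e, norm_neg, norm_smul] at h
  simpa [norm_pt2] using h

/-- A curve whose end point is obtained from its starting point by a half-turn screw motion about
the axis over a point of `Δ` has length at least `π`. -/
theorem pi_le_integral_sSpeed_of_screw (h₁ : PC1 γ₁) (h₂ : PC1 γ₂) (h₃ : PC1 γ₃) {q₁ q₂ : ℝ}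
    (hq : pt2 q₁ q₂ ∈ Δ) (k : ℤ) (e₁ : γ₁ 1 = 2 * q₁ - γ₁ 0) (e₂ : γ₂ 1 = 2 * q₂ - γ₂ 0)
    (e₃ : γ₃ 1 = γ₃ 0 + (2 * π * k + π)) :
    π ≤ ∫ t in (0 : ℝ)..1, sSpeed Δ γ₁ γ₂ γ₃ t := by
  by_cases hnear : ∀ t ∈ Icc (0 : ℝ) 1, √((γ₁ t - q₁) ^ 2 + (γ₂ t - q₂) ^ 2) ≤ π / 2
  · exact pi_le_integral_sSpeed_of_near h₁ h₂ h₃ hq k e₁ e₂ e₃ hnear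
  push Not at hnear
  obtain ⟨t, ht, hfar⟩ := hnear
  have hint := intervalIntegrable_sSpeed (Δ := Δ) h₁ h₂ h₃
  rw [← intervalIntegral.integral_add_adjacent_intervals (b := t)
    (hint.mono_set (by rw [uIcc_of_le ht.1, uIcc_of_le zero_le_one]
                       exact Icc_subset_Icc_right ht.2))
    (hint.mono_set (by rw [uIcc_of_le ht.2, uIcc_of_le zero_le_one]
                       exact Icc_subset_Icc_left ht.1))]
  have a₁ := sqrt_le_integral_sSpeed (Δ := Δ) h₁ h₂ h₃ le_rfl ht.1 ht.2
  have a₂ := sqrt_le_integral_sSpeed (Δ := Δ) h₁ h₂ h₃ ht.1 ht.2 le_rfl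
  have a₃ := two_mul_sqrt_le_sqrt_add_sqrt (γ₁ t - q₁) (γ₂ t - q₂) (γ₁ 0 - q₁) (γ₂ 0 - q₂)
  have r₁ : γ₁ t - q₁ - (γ₁ 0 - q₁) = γ₁ t - γ₁ 0 := by ring
  have r₂ : γ₂ t - q₂ - (γ₂ 0 - q₂) = γ₂ t - γ₂ 0 := by ring
  have r₃ : -(γ₁ 0 - q₁) - (γ₁ t - q₁) = γ₁ 1 - γ₁ t := by rw [e₁]; ring
  have r₄ : -(γ₂ 0 - q₂) - (γ₂ t - q₂) = γ₂ 1 - γ₂ t := by rw [e₂]; ring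
  rw [r₁, r₂, r₃, r₄] at a₃
  linarith

/-- If the covering radius of `Δ` is at most `π / 3`, a curve is at least half as long as its
vertical displacement. -/
theorem abs_sub_div_two_le_integral_sSpeed (h₁ : PC1 γ₁) (h₂ : PC1 γ₂) (h₃ : PC1 γ₃)
    (hΔ : ∀ x y, Metric.infDist (pt2 x y) Δ ≤ π / 3) :
    |γ₃ 1 - γ₃ 0| / 2 ≤ ∫ t in (0 : ℝ)..1, sSpeed Δ γ₁ γ₂ γ₃ t := by
  have key : ∀ ε : ℝ, |ε| = 1 / 2 →
      ε * γ₃ 1 - ε * γ₃ 0 ≤ ∫ t in (0 : ℝ)..1, sSpeed Δ γ₁ γ₂ γ₃ t := fun ε hε => by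
    refine sub_le_integral_sSpeed (g := fun t => ε * γ₃ t) (g' := fun t => ε * deriv γ₃ t)
      h₁ h₂ h₃ le_rfl zero_le_one le_rfl (h₃.continuousOn.const_mul ε)
      (fun t _ _ _ d₃ => ⟨d₃.hasDerivAt.const_mul ε, abs_le_sqrt ?_⟩)
    have hcos : |ε| ≤ cos (Metric.infDist (pt2 (γ₁ t) (γ₂ t)) Δ) := by
      rw [hε, ← cos_pi_div_three]
      exact cos_le_cos_of_nonneg_of_le_pi Metric.infDist_nonneg (by linarith [pi_pos]) (hΔ _ _)
    have hsq : ε ^ 2 ≤ cos (Metric.infDist (pt2 (γ₁ t) (γ₂ t)) Δ) ^ 2 := by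
      rw [← sq_abs ε]; gcongr
    nlinarith [mul_le_mul_of_nonneg_right hsq (sq_nonneg (deriv γ₃ t)), sq_nonneg (deriv γ₁ t),
      sq_nonneg (deriv γ₂ t)]
  have h1 := key (1 / 2) (by norm_num)
  have h2 := key (-(1 / 2)) (by norm_num)
  rcases abs_cases (γ₃ 1 - γ₃ 0) with h | h <;> rw [h.1] <;> linarith

end curve

theorem mem_ΔhexE_pi_div_four (m n : ℤ) :
    pt2 (π / 2 * m + π / 4 * n) (π / 4 * √3 * n) ∈ ΔhexE (π / 4) :=
  ⟨m, n, by congr 1; ring⟩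

theorem infDist_ΔhexE_le (x y : ℝ) : Metric.infDist (pt2 x y) (ΔhexE (π / 4)) ≤ π / 3 := by
  have hπ := pi_pos
  have h3 : √3 ^ 2 = 3 := sq_sqrt (by norm_num)
  have h3' : 0 < √3 := by positivity
  set n := round (y / (π / 4 * √3)) with hn
  set m := round ((x - π / 4 * n) / (π / 2)) with hm
  refine (infDist_pt2_le (mem_ΔhexE_pi_div_four m n) x y).trans (sqrt_le_iff.2 ⟨by positivity, ?_⟩)
  have e₁ : x - (π / 2 * m + π / 4 * n) = π / 2 * ((x - π / 4 * n) / (π / 2) - m) := by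
    field_simp; ring
  have e₂ : y - π / 4 * √3 * n = π / 4 * √3 * (y / (π / 4 * √3) - n) := by
    field_simp
  have b₁ := abs_le.1 (abs_sub_round ((x - π / 4 * n) / (π / 2)))
  have b₂ := abs_le.1 (abs_sub_round (y / (π / 4 * √3)))
  rw [← hm] at b₁
  rw [← hn] at b₂
  have c₁ := sq_le_sq' (by linarith [b₁.1]) b₁.2
  have c₂ := sq_le_sq' (by linarith [b₂.1]) b₂.2
  rw [e₁, e₂, mul_pow, mul_pow, mul_pow, h3]
  nlinarith [mul_le_mul_of_nonneg_left c₁ (sq_nonneg π), mul_le_mul_of_nonneg_left c₂ (sq_nonneg π),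
    sq_nonneg π]

/-- Every element of `Γ₂` is either a translation by `Λ` or a half-turn screw motion whose axis is
vertical over a point of `Δ_hex(π/4)`. -/
theorem exists_eq_of_mem_Γ₂ {g : Equiv.Perm (ℝ × ℝ × ℝ)} (hg : g ∈ Γ₂) :
    ∃ m n k : ℤ,
      (∀ x y z, g (x, y, z) = (π * m + π / 2 * n + x, π / 2 * √3 * n + y, z + 2 * π * k)) ∨
      (∀ x y z, g (x, y, z) =
        (π * m + π / 2 * n - x, π / 2 * √3 * n - y, z + (2 * π * k + π))) := by
  induction hg using Subgroup.closure_induction with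
  | mem g hg =>
    rcases hg with ⟨w, ⟨m, n, k, rfl⟩, rfl⟩ | rfl
    · refine ⟨m, n, k, .inl fun x y z => ?_⟩
      simp only [Equiv.coe_addLeft, Prod.mk_add_mk, Prod.mk.injEq]
      refine ⟨?_, ?_, ?_⟩ <;> ring
    · refine ⟨0, 0, 0, .inr fun x y z => ?_⟩
      simp [sigma0Perm]
  | one => exact ⟨0, 0, 0, .inl fun x y z => by simp⟩
  | mul g h _ _ hg hh =>
    obtain ⟨m, n, k, hg | hg⟩ := hg <;> obtain ⟨m', n', k', hh | hh⟩ := hh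
    · refine ⟨m + m', n + n', k + k', .inl fun x y z => ?_⟩
      rw [Equiv.Perm.mul_apply, hh, hg]
      push_cast
      congr 1 <;> [ring; (congr 1 <;> ring)]
    · refine ⟨m + m', n + n', k + k', .inr fun x y z => ?_⟩
      rw [Equiv.Perm.mul_apply, hh, hg]
      push_cast
      congr 1 <;> [ring; (congr 1 <;> ring)]
    · refine ⟨m - m', n - n', k + k', .inr fun x y z => ?_⟩
      rw [Equiv.Perm.mul_apply, hh, hg]
      push_cast
      congr 1 <;> [ring; (congr 1 <;> ring)]
    · refine ⟨m - m', n - n', k + k' + 1, .inl fun x y z => ?_⟩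
      rw [Equiv.Perm.mul_apply, hh, hg]
      push_cast
      congr 1 <;> [ring; (congr 1 <;> ring)]
  | inv g _ hg =>
    obtain ⟨m, n, k, hg | hg⟩ := hg
    · refine ⟨-m, -n, -k, .inl fun x y z => ?_⟩
      rw [Equiv.Perm.inv_eq_iff_eq, hg]
      push_cast
      congr 1 <;> [ring; (congr 1 <;> ring)]
    · refine ⟨m, n, -k - 1, .inr fun x y z => ?_⟩
      rw [Equiv.Perm.inv_eq_iff_eq, hg]
      push_cast
      congr 1 <;> [ring; (congr 1 <;> ring)]

theorem one_le_sq_add_mul_add_sq {m n : ℤ} (h : ¬(m = 0 ∧ n = 0)) :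
    1 ≤ m ^ 2 + m * n + n ^ 2 := by
  by_contra! hlt
  have h0 : m ^ 2 + m * n + n ^ 2 ≤ 0 := by omega
  have hm : m = 0 := by nlinarith [sq_nonneg (m + 2 * n), sq_nonneg m]
  have hn : n = 0 := by nlinarith [sq_nonneg (n + 2 * m), sq_nonneg n]
  exact h ⟨hm, hn⟩

/-- Every noncontractible loop of `(C₂, g_hex)` has length at least `π`. -/
theorem pi_le_sLen_of_mem_Γ₂ {γ₁ γ₂ γ₃ : ℝ → ℝ} (h₁ : PC1 γ₁) (h₂ : PC1 γ₂) (h₃ : PC1 γ₃)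
    {g : Equiv.Perm (ℝ × ℝ × ℝ)} (hg : g ∈ Γ₂) (hg1 : g ≠ 1)
    (hγ : (γ₁ 1, γ₂ 1, γ₃ 1) = g (γ₁ 0, γ₂ 0, γ₃ 0)) :
    π ≤ sLen (ΔhexE (π / 4)) γ₁ γ₂ γ₃ := by
  change π ≤ ∫ t in (0 : ℝ)..1, sSpeed (ΔhexE (π / 4)) γ₁ γ₂ γ₃ t
  have hπ := pi_pos
  obtain ⟨m, n, k, h | h⟩ := exists_eq_of_mem_Γ₂ hg <;> rw [h] at hγ <;>
    simp only [Prod.mk.injEq] at hγ <;> obtain ⟨e₁, e₂, e₃⟩ := hγ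
  · by_cases hmn : m = 0 ∧ n = 0
    · refine le_trans ?_ (abs_sub_div_two_le_integral_sSpeed h₁ h₂ h₃ infDist_ΔhexE_le)
      have hk : k ≠ 0 := fun hk => hg1 <| by
        ext1 ⟨x, y, z⟩
        simp [h, hmn, hk]
      have hk1 : (1 : ℝ) ≤ |(k : ℝ)| := by exact_mod_cast Int.one_le_abs hk
      rw [e₃, add_sub_cancel_left, abs_mul, abs_of_pos (by positivity)]
      nlinarith
    · refine le_trans ?_ (sqrt_le_integral_sSpeed h₁ h₂ h₃ le_rfl zero_le_one le_rfl)
      have h1 : (1 : ℝ) ≤ m ^ 2 + m * n + n ^ 2 := by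
        exact_mod_cast one_le_sq_add_mul_add_sq hmn
      have h3 : √3 ^ 2 = 3 := sq_sqrt (by norm_num)
      refine le_sqrt_of_sq_le ?_
      have e : (γ₁ 1 - γ₁ 0) ^ 2 + (γ₂ 1 - γ₂ 0) ^ 2 = π ^ 2 * (m ^ 2 + m * n + n ^ 2) := by
        rw [e₁, e₂]
        linear_combination (π ^ 2 * n ^ 2 / 4) * h3
      rw [e]
      nlinarith [sq_nonneg π]
  · exact pi_le_integral_sSpeed_of_screw h₁ h₂ h₃ (mem_ΔhexE_pi_div_four m n) k
      (by rw [e₁]; ring) (by rw [e₂]; ring) e₃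

theorem sigma0Perm_ne_one : sigma0Perm ≠ 1 := fun h => by
  have := congrArg (fun g : Equiv.Perm (ℝ × ℝ × ℝ) => (g (0, 0, 0)).2.2) h
  simp [sigma0Perm, pi_ne_zero] at this

theorem ContDiff.pc1 {f : ℝ → ℝ} (hf : ContDiff ℝ 1 f) : PC1 f :=
  ⟨1, fun i => i, by simp, by simp, fun i _ => by simp, hf.continuous.continuousOn,
    fun i _ => hf.contDiffOn⟩

theorem sLen_vertical : sLen (ΔhexE (π / 4)) (fun _ => 0) (fun _ => 0) (fun t => π * t) = π := by
  have h0 : Metric.infDist (pt2 0 0) (ΔhexE (π / 4)) = 0 :=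
    Metric.infDist_zero_of_mem (by simpa using mem_ΔhexE_pi_div_four 0 0)
  have hd : ∀ t, deriv (fun t => π * t) t = π := fun t => by simp
  simp [sLen, h0, hd, sqrt_sq pi_pos.le]

theorem isLeast_systole :
    IsLeast {L : ℝ | ∃ g ∈ Γ₂, g ≠ 1 ∧ ∃ γ₁ γ₂ γ₃ : ℝ → ℝ,
        PC1 γ₁ ∧ PC1 γ₂ ∧ PC1 γ₃ ∧
        (γ₁ 1, γ₂ 1, γ₃ 1) = g (γ₁ 0, γ₂ 0, γ₃ 0) ∧
        L = sLen (ΔhexE (π / 4)) γ₁ γ₂ γ₃} π := by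
  refine ⟨⟨sigma0Perm, Subgroup.subset_closure (.inr rfl), sigma0Perm_ne_one, fun _ => 0,
    fun _ => 0, fun t => π * t, contDiff_const.pc1, contDiff_const.pc1,
    (contDiff_const.mul contDiff_id).pc1, by simp [sigma0Perm], sLen_vertical.symm⟩, ?_⟩
  rintro L ⟨g, hg, hg1, γ₁, γ₂, γ₃, h₁, h₂, h₃, hγ, rfl⟩
  exact pi_le_sLen_of_mem_Γ₂ h₁ h₂ h₃ hg hg1 hγ

theorem integral_const_sub_abs {a : ℝ} (ha : 0 ≤ a) (b : ℝ) :
    ∫ x in -a..a, (b - |x|) = 2 * a * b - a ^ 2 := by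
  have hc : Continuous fun x : ℝ => b - |x| := by fun_prop
  rw [← intervalIntegral.integral_add_adjacent_intervals (b := 0)
    (hc.intervalIntegrable _ _) (hc.intervalIntegrable _ _)]
  have h₁ : ∫ x in -a..0, (b - |x|) = ∫ x in -a..0, (b + x) :=
    intervalIntegral.integral_congr fun x hx => by
      rw [uIcc_of_le (by linarith)] at hx
      simp only [abs_of_nonpos hx.2, sub_neg_eq_add]
  have h₂ : ∫ x in 0..a, (b - |x|) = ∫ x in 0..a, (b - x) :=
    intervalIntegral.integral_congr fun x hx => by
      rw [uIcc_of_le ha] at hx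
      simp only [abs_of_nonneg hx.1]
  rw [h₁, h₂, intervalIntegral.integral_add (by simp) (by simp),
    intervalIntegral.integral_sub (by simp) (by simp)]
  simp only [intervalIntegral.integral_const, integral_id, smul_eq_mul]
  ring

theorem abs_le_of_mem_vorCell {a : ℝ} (ha : 0 < a) {p : EuclideanSpace ℝ (Fin 2)}
    (hp : p ∈ vorCell (ΔhexE a)) : |p 0| ≤ a ∧ |p 1| ≤ (2 * a - |p 0|) / √3 := by
  have h3 : √3 ^ 2 = 3 := sq_sqrt (by norm_num)
  have key : ∀ m n : ℤ, 2 * (p 0 * (2 * m + n) + p 1 * (√3 * n)) ≤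
      a * ((2 * m + n) ^ 2 + 3 * n ^ 2) := fun m n => by
    have h := hp _ ⟨m, n, rfl⟩
    have hp' : p = pt2 (p 0) (p 1) := by ext i; fin_cases i <;> simp [pt2]
    rw [hp', pt2_sub, norm_pt2, norm_pt2] at h
    have h' := (sqrt_le_sqrt_iff (by positivity)).1 h
    refine le_of_mul_le_mul_left ?_ ha
    linear_combination h' + (a ^ 2 * n ^ 2) * h3
  have k₁ := key 1 0
  have k₂ := key (-1) 0
  have k₃ := key 0 1
  have k₄ := key 0 (-1)
  have k₅ := key 1 (-1)
  have k₆ := key (-1) 1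
  push_cast at k₁ k₂ k₃ k₄ k₅ k₆
  refine ⟨abs_le.2 ⟨by linarith, by linarith⟩, ?_⟩
  rw [le_div_iff₀ (by positivity)]
  rcases abs_cases (p 0) with h | h <;> rcases abs_cases (p 1) with h' | h' <;>
    rw [h.1, h'.1] <;> linarith

theorem volume_vorCell_ΔhexE_le {a : ℝ} (ha : 0 < a) :
    volume (vorCell (ΔhexE a)) ≤ ENNReal.ofReal (2 * √3 * a ^ 2) := by
  set Q : Set (ℝ × ℝ) := {p | |p.1| ≤ a ∧ |p.2| ≤ (2 * a - |p.1|) / √3} with hQ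
  have hQm : MeasurableSet Q := by
    rw [hQ, ofPred_and]
    exact ((isClosed_le (by fun_prop) (by fun_prop)).inter
      (isClosed_le (by fun_prop) (by fun_prop))).measurableSet
  have hmp := (volume_preserving_finTwoArrow ℝ).comp (PiLp.volume_preserving_ofLp (Fin 2))
  calc volume (vorCell (ΔhexE a)) ≤ volume
        ((MeasurableEquiv.finTwoArrow ∘ WithLp.ofLp) ⁻¹' Q : Set (EuclideanSpace ℝ (Fin 2))) :=
        measure_mono fun p hp => abs_le_of_mem_vorCell ha hp
    _ = volume Q := hmp.measure_preimage hQm.nullMeasurableSet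
    _ = ∫⁻ x, volume (Prod.mk x ⁻¹' Q) := Measure.prod_apply hQm
    _ ≤ ∫⁻ x, (Icc (-a) a).indicator
          (fun x => ENNReal.ofReal (2 / √3 * (2 * a - |x|))) x := by
        refine lintegral_mono fun x => ?_
        by_cases hx : x ∈ Icc (-a) a
        · rw [indicator_of_mem hx]
          calc volume (Prod.mk x ⁻¹' Q)
              ≤ volume (Icc (-((2 * a - |x|) / √3)) ((2 * a - |x|) / √3)) :=
                measure_mono fun y hy => abs_le.1 hy.2
            _ ≤ _ := by
              rw [Real.volume_Icc]
              exact ENNReal.ofReal_le_ofReal (le_of_eq (by ring))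
        · have : Prod.mk x ⁻¹' Q = ∅ :=
            eq_empty_of_forall_notMem fun y hy => hx (abs_le.1 hy.1)
          simp [this]
    _ = ∫⁻ x in Icc (-a) a, ENNReal.ofReal (2 / √3 * (2 * a - |x|)) :=
        lintegral_indicator measurableSet_Icc _
    _ = ENNReal.ofReal (∫ x in Icc (-a) a, 2 / √3 * (2 * a - |x|)) := by
        refine (ofReal_integral_eq_lintegral_ofReal ?_ ?_).symm
        · exact Continuous.integrableOn_Icc (by fun_prop)
        · filter_upwards [ae_restrict_mem measurableSet_Icc] with x hx
          have := abs_le.2 hx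
          exact mul_nonneg (by positivity) (by linarith)
    _ = ENNReal.ofReal (2 * √3 * a ^ 2) := by
        have h3 : √3 ^ 2 = 3 := sq_sqrt (by norm_num)
        rw [integral_Icc_eq_integral_Ioc, ← intervalIntegral.integral_of_le (by linarith),
          intervalIntegral.integral_const_mul, integral_const_sub_abs ha.le]
        congr 1
        field_simp
        linear_combination -h3

theorem isClosed_vorCell (Δ : Set (EuclideanSpace ℝ (Fin 2))) : IsClosed (vorCell Δ) := by
  have : vorCell Δ = ⋂ q ∈ Δ, {p | ‖p‖ ≤ ‖p - q‖} := by ext p; simp [vorCell]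
  rw [this]
  exact isClosed_biInter fun q _ => isClosed_le (by fun_prop) (by fun_prop)

/-- The integral of `cos ‖p‖` over a subset of the disc of radius `2π` is less than any upper bound
for its volume. -/
theorem setIntegral_cos_norm_lt {H : Set (EuclideanSpace ℝ (Fin 2))} {V : ℝ} (hV : 0 < V)
    (hHV : volume H ≤ ENNReal.ofReal V) (hH : ∀ p ∈ H, ‖p‖ < 2 * π) (hHm : MeasurableSet H) :
    ∫ p in H, cos ‖p‖ < V := by
  have hfin : volume H ≠ ⊤ := (hHV.trans_lt ENNReal.ofReal_lt_top).ne
  have hreal : volume.real H ≤ V := ENNReal.toReal_le_of_le_ofReal hV.le hHV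
  rcases eq_or_ne (volume H) 0 with h0 | h0
  · rwa [Measure.restrict_eq_zero.2 h0, integral_zero_measure]
  have : IsFiniteMeasure (volume.restrict H) := ⟨by simpa using hfin.lt_top⟩
  have hcos : Integrable (fun p : EuclideanSpace ℝ (Fin 2) => cos ‖p‖) (volume.restrict H) :=
    (integrable_const (1 : ℝ)).mono' (by fun_prop) (.of_forall fun p => abs_cos_le_one _)
  have hpos : 0 < ∫ p in H, (1 - cos ‖p‖) := by
    rw [integral_pos_iff_support_of_nonneg (fun p => sub_nonneg.2 (cos_le_one _))
      ((integrable_const 1).sub hcos), pos_iff_ne_zero]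
    intro hz
    refine h0 (measure_mono_null (t := {0} ∪ (Function.support
      (fun p : EuclideanSpace ℝ (Fin 2) => 1 - cos ‖p‖) ∩ H)) (fun p hp => ?_) ?_)
    · by_cases hp0 : cos ‖p‖ = 1
      · rw [cos_eq_one_iff_of_lt_of_lt (by linarith [norm_nonneg p, pi_pos]) (hH p hp),
          norm_eq_zero] at hp0
        exact .inl hp0
      · exact .inr ⟨fun h => hp0 (by linarith), hp⟩
    · rw [Measure.restrict_apply' hHm] at hz
      exact measure_union_null (measure_singleton _) hz
  rw [integral_sub (integrable_const 1) hcos] at hpos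
  simp only [integral_const, measureReal_restrict_apply_univ, smul_eq_mul, mul_one] at hpos
  linarith

theorem norm_lt_of_mem_vorCell {p : EuclideanSpace ℝ (Fin 2)}
    (hp : p ∈ vorCell (ΔhexE (π / 4))) : ‖p‖ < 2 * π := by
  have hπ := pi_pos
  obtain ⟨h0, h1⟩ := abs_le_of_mem_vorCell (by positivity) hp
  have h3 : 1 ≤ √3 := one_le_sqrt.2 (by norm_num)
  have h1' : |p 1| ≤ π / 2 := h1.trans <| by
    rw [div_le_iff₀ (by positivity)]
    nlinarith [abs_nonneg (p 0)]
  have hp' : p = pt2 (p 0) (p 1) := by ext i; fin_cases i <;> simp [pt2]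
  rw [hp', norm_pt2]
  refine (sqrt_lt' (by positivity)).2 ?_
  nlinarith [sq_le_sq' (abs_le.1 h0).1 (abs_le.1 h0).2, sq_le_sq' (abs_le.1 h1').1 (abs_le.1 h1').2]

/-- for `a = π/4`, (i) the systole of `(C₂, g_hex)` equals `π`, and (ii) with
`V = 4π∫_{H(Δ)} cos‖p‖ dp` the volume of `(C₂, g_hex)`, one has `π³ > (2/√3)·V`; hence the
systolic ratio of `(C₂, g_hex)` exceeds `2/√3`, the optimal flat systolic ratio on `C₂`. -/
theorem C2_hexagonal_beats_flat :
    sInf {L : ℝ | ∃ g ∈ Γ₂, g ≠ 1 ∧ ∃ γ₁ γ₂ γ₃ : ℝ → ℝ,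
        PC1 γ₁ ∧ PC1 γ₂ ∧ PC1 γ₃ ∧
        (γ₁ 1, γ₂ 1, γ₃ 1) = g (γ₁ 0, γ₂ 0, γ₃ 0) ∧
        L = sLen (ΔhexE (π / 4)) γ₁ γ₂ γ₃} = π ∧
    π ^ 3 > 2 / Real.sqrt 3 *
      (4 * π * ∫ p in vorCell (ΔhexE (π / 4)), Real.cos ‖p‖) := by
  refine ⟨isLeast_systole.csInf_eq, ?_⟩
  have hπ := pi_pos
  have hlt := setIntegral_cos_norm_lt (by positivity) (volume_vorCell_ΔhexE_le (by positivity))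
    (fun p hp => norm_lt_of_mem_vorCell hp) (isClosed_vorCell (ΔhexE (π / 4))).measurableSet
  calc 2 / √3 * (4 * π * ∫ p in vorCell (ΔhexE (π / 4)), cos ‖p‖)
      < 2 / √3 * (4 * π * (2 * √3 * (π / 4) ^ 2)) := by gcongr
    _ = π ^ 3 := by field_simp; norm_num

end
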